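/- There is no function f : ℕ → ℝ and constant c ∈ ℕ such that for all natural numbers k and n and every graph G on n vertices, the polytope STAB_k(G) admits an extended formulation of size at most f(k)·n^c. Equivalently: for every f : ℕ → ℝ and every c ∈ ℕ there exist k, n and a graph G on n vertices such that every extended formulation of STAB_k(G) has size greater than f(k)·n^c. -/

import Mathlib

/-- A set of vertices is independent in `G` if no two of its elements are adjacent. -/
def IsIndepSet {V : Type*} (G : SimpleGraph V) (S : Set V) : Prop :=
  ∀ ⦃u⦄, u ∈ S → ∀ ⦃v⦄, v ∈ S → ¬ G.Adj u v

/-- The characteristic vector of a finite vertex set `S`. -/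
noncomputable def charVec {V : Type*} (S : Finset V) : V → ℝ :=
  Set.indicator (↑S) (fun _ => 1)

/-- `STAB G k`: the convex hull of characteristic vectors of independent sets of size
exactly `k`. -/
noncomputable def STAB {V : Type*} (G : SimpleGraph V) (k : ℕ) : Set (V → ℝ) :=
  convexHull ℝ {x | ∃ S : Finset V, IsIndepSet G ↑S ∧ S.card = k ∧ x = charVec S}

/-- `STABle G k`: the convex hull of characteristic vectors of independent sets of size
at most `k`. -/
noncomputable def STABle {V : Type*} (G : SimpleGraph V) (k : ℕ) : Set (V → ℝ) :=
  convexHull ℝ {x | ∃ S : Finset V, IsIndepSet G ↑S ∧ S.card ≤ k ∧ x = charVec S}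

/-- `P ⊆ ℝ^V` admits an extended formulation of size `N`: there is a polyhedron
`Q = {x : A x ≤ b, C x = d}` where `A` has `N` rows, and a linear projection `π`
with `π(Q) = P`. -/
def HasEF {V : Type*} (P : Set (V → ℝ)) (N : ℕ) : Prop :=
  ∃ (m p : ℕ) (A : Matrix (Fin N) (Fin m) ℝ) (b : Fin N → ℝ)
    (C : Matrix (Fin p) (Fin m) ℝ) (d : Fin p → ℝ)
    (π : (Fin m → ℝ) →ₗ[ℝ] (V → ℝ)),
    π '' {x | A.mulVec x ≤ b ∧ C.mulVec x = d} = P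

/-- If the set of pairs `(a, b)` with `A a` and `B b` contains no pair with `|a ∩ b| = 1`, then
it contains at most `2 ^ n` disjoint pairs. -/
theorem sum_disjoint_le_two_pow {α : Type*} [DecidableEq α] (s : Finset α) :
    ∀ A B : Finset α → Prop,
      (∀ a ⊆ s, ∀ b ⊆ s, A a → B b → (a ∩ b).card ≠ 1) →
      (∑ a ∈ s.powerset, ∑ b ∈ s.powerset,
        open Classical in if Disjoint a b ∧ A a ∧ B b then 1 else 0) ≤ 2 ^ s.card := by
  classical
  induction s using Finset.induction_on with
  | empty =>
    intro A B _
    simp only [Finset.powerset_empty, Finset.sum_singleton]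
    split_ifs <;> simp
  | insert x s hx ih =>
    intro A B h
    have h₁ := ih (fun a => A a ∨ A (insert x a)) B (by
      rintro a ha b hb (hA | hA) hB
      · exact h a (ha.trans (Finset.subset_insert _ _)) b (hb.trans (Finset.subset_insert _ _)) hA hB
      · have := h _ (Finset.insert_subset_insert x ha) b (hb.trans (Finset.subset_insert _ _)) hA hB
        rwa [Finset.insert_inter_of_notMem (fun hxb => hx (hb hxb))] at this)
    have h₂ := ih A (fun b => B b ∨ B (insert x b)) (by
      rintro a ha b hb hA (hB | hB)
      · exact h a (ha.trans (Finset.subset_insert _ _)) b (hb.trans (Finset.subset_insert _ _)) hA hB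
      · have := h a (ha.trans (Finset.subset_insert _ _)) _ (Finset.insert_subset_insert x hb) hA hB
        rwa [Finset.inter_insert_of_notMem (fun hxa => hx (ha hxa))] at this)
    rw [Finset.card_insert_of_notMem hx, pow_succ, mul_two]
    refine le_trans ?_ (add_le_add h₁ h₂)
    simp only [Finset.sum_powerset_insert hx, ← Finset.sum_add_distrib]
    refine Finset.sum_le_sum fun a ha => Finset.sum_le_sum fun b hb => ?_
    rw [Finset.mem_powerset] at ha hb
    have hxa : x ∉ a := fun h => hx (ha h)
    have hxb : x ∉ b := fun h => hx (hb h)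
    have hAB : Disjoint a b → A (insert x a) → B (insert x b) → False := fun hd hA hB =>
      h _ (Finset.insert_subset_insert x ha) _ (Finset.insert_subset_insert x hb) hA hB (by
        rw [← Finset.insert_inter_distrib, Finset.disjoint_iff_inter_eq_empty.mp hd]; simp)
    simp only [Finset.disjoint_insert_left, Finset.disjoint_insert_right, hxa, hxb,
      Finset.mem_insert, true_or, not_true_eq_false, false_and, not_false_eq_true, true_and,
      if_false, add_zero]
    by_cases hd : Disjoint a b
    · have := hAB hd
      by_cases hA : A a <;> by_cases hA' : A (insert x a) <;> by_cases hB : B b <;>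
        by_cases hB' : B (insert x b) <;> simp_all
    · simp [hd]

/-- There are `3 ^ n` pairs of disjoint subsets of an `n`-element set. -/
theorem sum_disjoint_eq_three_pow {α : Type*} [DecidableEq α] (s : Finset α) :
    (∑ a ∈ s.powerset, ∑ b ∈ s.powerset, if Disjoint a b then 1 else 0) = 3 ^ s.card := by
  induction s using Finset.induction_on with
  | empty => simp
  | insert x s hx ih =>
    rw [Finset.card_insert_of_notMem hx, pow_succ, ← ih, mul_comm, Finset.mul_sum]
    simp only [Finset.sum_powerset_insert hx, ← Finset.sum_add_distrib, Finset.mul_sum]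
    refine Finset.sum_congr rfl fun a ha => Finset.sum_congr rfl fun b hb => ?_
    rw [Finset.mem_powerset] at ha hb
    have hxa : x ∉ a := fun h => hx (ha h)
    have hxb : x ∉ b := fun h => hx (hb h)
    by_cases hd : Disjoint a b <;>
      simp [Finset.disjoint_insert_left, Finset.disjoint_insert_right, hxa, hxb, hd]

/-- A family of combinatorial rectangles that covers all disjoint pairs and contains no pair
with intersection of size one has at least `(3 / 2) ^ n` members. -/
theorem three_pow_le_of_rectangle_cover {α ι : Type*} [Fintype α] [DecidableEq α] [Fintype ι]
    (I J : Finset α → Set ι)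
    (hcover : ∀ a b, Disjoint a b → ∃ i, i ∈ I a ∧ i ∈ J b)
    (havoid : ∀ a b, (a ∩ b).card = 1 → ∀ i, i ∈ I a → i ∉ J b) :
    3 ^ Fintype.card α ≤ Fintype.card ι * 2 ^ Fintype.card α := by
  classical
  rw [← Finset.card_univ (α := α), ← sum_disjoint_eq_three_pow]
  have hrect : ∀ i : ι, _ := fun i =>
    sum_disjoint_le_two_pow (Finset.univ : Finset α) (fun a => i ∈ I a) (fun b => i ∈ J b)
      (fun a _ b _ ha hb hc => havoid a b hc i ha hb)
  calc _ ≤ ∑ a ∈ (Finset.univ : Finset α).powerset, ∑ b ∈ (Finset.univ : Finset α).powerset,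
        ∑ i : ι, if Disjoint a b ∧ i ∈ I a ∧ i ∈ J b then 1 else 0 := by
        refine Finset.sum_le_sum fun a _ => Finset.sum_le_sum fun b _ => ?_
        split_ifs with hd
        · obtain ⟨i, hi⟩ := hcover a b hd
          refine le_trans ?_ (Finset.single_le_sum (fun _ _ => Nat.zero_le _) (Finset.mem_univ i))
          simp [hd, hi]
        · exact Nat.zero_le _
    _ = ∑ i : ι, ∑ a ∈ (Finset.univ : Finset α).powerset,
        ∑ b ∈ (Finset.univ : Finset α).powerset,
          if Disjoint a b ∧ i ∈ I a ∧ i ∈ J b then 1 else 0 := by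
        rw [Finset.sum_comm (s := (Finset.univ : Finset ι))]
        exact Finset.sum_congr rfl fun a _ => Finset.sum_comm
    _ ≤ ∑ _i : ι, 2 ^ (Finset.univ : Finset α).card := Finset.sum_le_sum fun i _ => by
        convert hrect i
    _ = _ := by simp

/-- An extended formulation with `N` inequalities yields a cover of the support of a slack
matrix by `N` rectangles. -/
theorem HasEF.exists_rectangle_cover {V ι κ : Type*} {P : Set (V → ℝ)} {N : ℕ} (hP : HasEF P N)
    (L : ι → (V → ℝ) →ₗ[ℝ] ℝ) (β : ι → ℝ) (p : κ → V → ℝ) (hp : ∀ j, p j ∈ P)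
    (hL : ∀ i, ∀ x ∈ P, L i x ≤ β i) (hface : ∀ i, ∃ x ∈ P, L i x = β i) :
    ∃ (I : ι → Set (Fin N)) (J : κ → Set (Fin N)),
      (∀ i j, L i (p j) < β i → ∃ t, t ∈ I i ∧ t ∈ J j) ∧
      ∀ i j, L i (p j) = β i → ∀ t, t ∈ I i → t ∉ J j := by
  classical
  obtain ⟨m, q, A, b, C, d, π, rfl⟩ := hP
  choose x hxQ hxp using hp
  refine ⟨fun i => {t | ∀ y, A.mulVec y ≤ b → C.mulVec y = d → L i (π y) = β i →
    A.mulVec y t = b t}, fun j => {t | A.mulVec (x j) t ≠ b t}, ?_, ?_⟩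
  swap
  · intro i j hij t ht
    simpa using ht (x j) (hxQ j).1 (hxQ j).2 (by rw [hxp, hij])
  intro i j hij
  by_contra! hcon
  simp only [Set.mem_ofPred_eq, not_not] at hcon
  -- a point in the relative interior of the face
  have hrelint : ∀ T : Finset (Fin N), ∃ y, A.mulVec y ≤ b ∧ C.mulVec y = d ∧ L i (π y) = β i ∧
      ∀ t ∈ T, A.mulVec (x j) t ≠ b t → A.mulVec y t < b t := by
    intro T
    induction T using Finset.induction_on with
    | empty =>
      obtain ⟨_, ⟨y, hy, rfl⟩, hyL⟩ := hface i
      exact ⟨y, hy.1, hy.2, hyL, by simp⟩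
    | insert t T _ ih =>
      obtain ⟨y, hyA, hyC, hyL, hyT⟩ := ih
      by_cases ht : A.mulVec (x j) t = b t
      · refine ⟨y, hyA, hyC, hyL, fun u hu hne => ?_⟩
        rcases Finset.mem_insert.mp hu with rfl | hu
        · exact absurd ht hne
        · exact hyT u hu hne
      · have := mt (hcon t) ht
        push Not at this
        obtain ⟨z, hzA, hzC, hzL, hzt⟩ := this
        have hval : ∀ u, A.mulVec ((1 / 2 : ℝ) • y + (1 / 2 : ℝ) • z) u =
            1 / 2 * A.mulVec y u + 1 / 2 * A.mulVec z u := fun u => by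
          simp [Matrix.mulVec_add, Matrix.mulVec_smul]
        refine ⟨(1 / 2 : ℝ) • y + (1 / 2 : ℝ) • z, fun u => ?_, ?_, ?_, fun u hu hne => ?_⟩
        · rw [hval]
          linarith [hyA u, hzA u]
        · rw [Matrix.mulVec_add, Matrix.mulVec_smul, Matrix.mulVec_smul, hyC, hzC, ← add_smul]
          norm_num
        · simp only [map_add, map_smul, hyL, hzL, smul_eq_mul]
          ring
        · rw [hval]
          rcases Finset.mem_insert.mp hu with rfl | hu
          · linarith [hyA u, lt_of_le_of_ne (hzA u) hzt]
          · linarith [hyT u hu hne, hzA u]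
  obtain ⟨y, hyA, hyC, hyL, hyT⟩ := hrelint Finset.univ
  have hval : ∀ (ε : ℝ) u, A.mulVec (y + ε • (y - x j)) u =
      A.mulVec y u + ε * (A.mulVec y u - A.mulVec (x j) u) := fun ε u => by
    simp [Matrix.mulVec_add, Matrix.mulVec_smul, Matrix.mulVec_sub]
  have hev : ∀ᶠ ε : ℝ in nhdsWithin 0 (Set.Ioi 0), ∀ u, A.mulVec (y + ε • (y - x j)) u ≤ b u := by
    refine Filter.eventually_all.mpr fun u => ?_
    simp only [hval]
    by_cases hu : A.mulVec (x j) u = b u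
    · filter_upwards [self_mem_nhdsWithin] with ε hε
      have : (0 : ℝ) < ε := hε
      nlinarith [hyA u]
    · have hlt := hyT u (Finset.mem_univ u) hu
      have hc : Filter.Tendsto
          (fun ε : ℝ => A.mulVec y u + ε * (A.mulVec y u - A.mulVec (x j) u))
          (nhdsWithin 0 (Set.Ioi 0)) (nhds (A.mulVec y u)) := by
        refine Filter.Tendsto.mono_left ?_ nhdsWithin_le_nhds
        refine Continuous.tendsto' (by fun_prop) _ _ (by simp)
      exact (hc.eventually_lt_const hlt).mono fun _ h => h.le
  obtain ⟨ε, hεA, hε⟩ := (hev.and self_mem_nhdsWithin).exists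
  have hε' : (0 : ℝ) < ε := hε
  have hmem := hL i (π (y + ε • (y - x j))) ⟨_, ⟨hεA, by
    simp [Matrix.mulVec_add, Matrix.mulVec_smul, Matrix.mulVec_sub, hyC, (hxQ j).2]⟩, rfl⟩
  simp only [map_add, map_smul, map_sub, hyL, hxp, smul_eq_mul] at hmem
  nlinarith

/-- A linear bound that holds for all independent sets of size `k` holds on `STAB G k`. -/
theorem linearMap_le_of_mem_STAB {V : Type*} {G : SimpleGraph V} {k : ℕ} (L : (V → ℝ) →ₗ[ℝ] ℝ)
    (β : ℝ) (h : ∀ S : Finset V, IsIndepSet G ↑S → S.card = k → L (charVec S) ≤ β) :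
    ∀ x ∈ STAB G k, L x ≤ β := by
  intro x hx
  refine convexHull_min ?_ (convex_halfSpace_le L.isLinear β) hx
  rintro _ ⟨S, hS, hk, rfl⟩
  exact h S hS hk

/-- Vertices of the block consistency graph: a pair of blocks together with a local assignment
to each of them. -/
abbrev BlockVertex (K s : ℕ) : Type :=
  (Fin K × Fin K) × (Finset (Fin s) × Finset (Fin s))

/-- Two vertices are adjacent when their local assignments contradict each other. -/
def blockGraph (K s : ℕ) : SimpleGraph (BlockVertex K s) :=
  SimpleGraph.fromRel fun v w =>
    (v.1.1 = w.1.1 ∧ v.2.1 ≠ w.2.1) ∨ (v.1.2 = w.1.2 ∧ v.2.2 ≠ w.2.2) ∨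
      (v.1.2 = w.1.1 ∧ v.2.2 ≠ w.2.1)

/-- The part of a subset of `Fin K × Fin s` lying in block `i`. -/
def blockPart {K s : ℕ} (b : Finset (Fin K × Fin s)) (i : Fin K) : Finset (Fin s) :=
  Finset.univ.filter fun t => (i, t) ∈ b

/-- The independent set encoding a global assignment `b`. -/
def blockIndepSet {K s : ℕ} (b : Fin K → Finset (Fin s)) : Finset (BlockVertex K s) :=
  Finset.univ.map ⟨fun q : Fin K × Fin K => (q, (b q.1, b q.2)), fun _ _ h => (Prod.ext_iff.mp h).1⟩

theorem isIndepSet_blockIndepSet {K s : ℕ} (b : Fin K → Finset (Fin s)) :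
    IsIndepSet (blockGraph K s) ↑(blockIndepSet b) := by
  intro u hu v hv
  have h : ∀ v ∈ blockIndepSet b, v.2.1 = b v.1.1 ∧ v.2.2 = b v.1.2 := by
    intro v hv
    obtain ⟨q, -, rfl⟩ := Finset.mem_map.mp hv
    exact ⟨rfl, rfl⟩
  obtain ⟨hu₁, hu₂⟩ := h u hu
  obtain ⟨hv₁, hv₂⟩ := h v hv
  rw [blockGraph, SimpleGraph.fromRel_adj, hu₁, hu₂, hv₁, hv₂]
  grind

theorem card_blockIndepSet {K s : ℕ} (b : Fin K → Finset (Fin s)) :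
    (blockIndepSet b).card = K * K := by
  simp [blockIndepSet]

/-- Weights on the vertices of the block graph whose total over the independent set encoding `b`
is `1 - (1 - |a ∩ b|) ^ 2`. -/
def blockWeight {K s : ℕ} (a : Fin K → Finset (Fin s)) (v : BlockVertex K s) : ℝ :=
  if v.1.1 = v.1.2 then 2 * ((a v.1.1 ∩ v.2.1).card : ℝ) - ((a v.1.1 ∩ v.2.1).card : ℝ) ^ 2
  else -(((a v.1.1 ∩ v.2.1).card : ℝ) * ((a v.1.2 ∩ v.2.2).card : ℝ))

/-- The linear functional with coefficients `blockWeight a`. -/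
def blockFunctional {K s : ℕ} (a : Fin K → Finset (Fin s)) : (BlockVertex K s → ℝ) →ₗ[ℝ] ℝ :=
  ∑ v, blockWeight a v • LinearMap.proj v

theorem blockFunctional_charVec {K s : ℕ} (a : Fin K → Finset (Fin s))
    (S : Finset (BlockVertex K s)) :
    blockFunctional a (charVec S) = ∑ v ∈ S, blockWeight a v := by
  classical
  simp [blockFunctional, charVec, Set.indicator_apply]

theorem blockFunctional_blockIndepSet {K s : ℕ} (a b : Fin K → Finset (Fin s)) :
    blockFunctional a (charVec (blockIndepSet b)) =
      1 - (1 - ∑ i, ((a i ∩ b i).card : ℝ)) ^ 2 := by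
  have h : ∀ q : Fin K × Fin K, blockWeight a (q, (b q.1, b q.2)) =
      (if q.1 = q.2 then 2 * ((a q.1 ∩ b q.1).card : ℝ) else 0) -
        ((a q.1 ∩ b q.1).card : ℝ) * ((a q.2 ∩ b q.2).card : ℝ) := by
    rintro ⟨i, j⟩
    by_cases hij : i = j
    · subst hij
      simp [blockWeight, sq]
    · simp [blockWeight, hij]
  rw [blockFunctional_charVec, blockIndepSet, Finset.sum_map]
  refine (Finset.sum_congr rfl fun q _ => h q).trans ?_
  simp only [Finset.sum_sub_distrib, Fintype.sum_prod_type,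
    Finset.sum_ite_eq, Finset.mem_univ, if_true, ← Finset.mul_sum, ← Finset.sum_mul]
  ring

/-- Every independent set of maximum size encodes a global assignment, up to the irrelevant second
components of the diagonal vertices. -/
theorem exists_blockFunctional_eq {K s : ℕ} {S : Finset (BlockVertex K s)}
    (hS : IsIndepSet (blockGraph K s) ↑S) (hcard : S.card = K * K) :
    ∃ b : Fin K → Finset (Fin s), ∀ a,
      blockFunctional a (charVec S) = blockFunctional a (charVec (blockIndepSet b)) := by
  classical
  have hadj : ∀ v ∈ S, ∀ w ∈ S, v ≠ w →
      ¬ ((v.1.1 = w.1.1 ∧ v.2.1 ≠ w.2.1) ∨ (v.1.2 = w.1.2 ∧ v.2.2 ≠ w.2.2) ∨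
      (v.1.2 = w.1.1 ∧ v.2.2 ≠ w.2.1)) := fun v hv w hw hne h =>
    hS hv hw (by rw [blockGraph, SimpleGraph.fromRel_adj]; exact ⟨hne, Or.inl h⟩)
  have hinj : Set.InjOn Prod.fst (S : Set (BlockVertex K s)) := by
    intro v hv w hw h
    by_contra hne
    have := hadj v hv w hw hne
    exact hne (by ext1 <;> grind)
  have himage : S.image Prod.fst = Finset.univ :=
    Finset.eq_univ_of_card _ (by rw [Finset.card_image_of_injOn hinj, hcard]; simp)
  have hex : ∀ q : Fin K × Fin K, ∃ xy, (q, xy) ∈ S := fun q => by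
    have : q ∈ S.image Prod.fst := himage ▸ Finset.mem_univ q
    simpa using this
  choose σ hσ using hex
  refine ⟨fun i => (σ (i, i)).1, fun a => ?_⟩
  have hSeq : S = Finset.univ.map ⟨fun q : Fin K × Fin K => (q, σ q),
      fun _ _ h => (Prod.ext_iff.mp h).1⟩ := by
    ext v
    simp only [Finset.mem_map, Finset.mem_univ, true_and]
    refine ⟨fun hv => ⟨v.1, hinj (hσ _) hv rfl⟩, ?_⟩
    rintro ⟨q, rfl⟩
    exact hσ q
  rw [blockFunctional_charVec, blockFunctional_charVec, hSeq, blockIndepSet, Finset.sum_map,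
    Finset.sum_map]
  refine Finset.sum_congr rfl ?_
  rintro ⟨i, j⟩ -
  change blockWeight a ((i, j), σ (i, j)) = blockWeight a ((i, j), ((σ (i, i)).1, (σ (j, j)).1))
  by_cases hij : i = j
  · subst hij
    simp [blockWeight]
  · have h₁ := hadj _ (hσ (i, j)) _ (hσ (i, i)) (by simp [Ne.symm hij])
    have h₂ := hadj _ (hσ (i, j)) _ (hσ (j, j)) (by simp [hij])
    have e₁ : (σ (i, j)).1 = (σ (i, i)).1 := by grind
    have e₂ : (σ (i, j)).2 = (σ (j, j)).1 := by grind
    simp [blockWeight, e₁, e₂]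

theorem sum_card_blockPart_inter {K s : ℕ} (a b : Finset (Fin K × Fin s)) :
    ∑ i, ((blockPart a i ∩ blockPart b i).card : ℝ) = ((a ∩ b).card : ℝ) := by
  classical
  rw [← Nat.cast_sum, Finset.card_eq_sum_card_fiberwise (f := Prod.fst) (t := Finset.univ)
    (fun _ _ => Finset.mem_coe.mpr (Finset.mem_univ _))]
  congr 1
  refine Finset.sum_congr rfl fun i _ => ?_
  refine Finset.card_bij (fun t _ => (i, t)) ?_ ?_ ?_
  · intro t ht
    simpa [blockPart] using ht
  · intro t _ u _ h
    exact (Prod.ext_iff.mp h).2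
  · rintro ⟨j, t⟩ h
    simp only [Finset.mem_filter, Finset.mem_inter] at h
    obtain ⟨h, rfl⟩ := h
    exact ⟨t, by simpa [blockPart] using h, rfl⟩

/-- Extended formulations of `STAB (blockGraph K s) (K * K)` have size at least
`(3 / 2) ^ (K * s) - 1`. -/
theorem three_pow_le_of_hasEF_blockGraph {K s N : ℕ}
    (h : HasEF (STAB (blockGraph K s) (K * K)) N) :
    3 ^ (K * s) ≤ (N + 1) * 2 ^ (K * s) := by
  classical
  let p : Finset (Fin K × Fin s) → BlockVertex K s → ℝ :=
    fun b => charVec (blockIndepSet (blockPart b))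
  have hp : ∀ b, p b ∈ STAB (blockGraph K s) (K * K) := fun b =>
    subset_convexHull ℝ _ ⟨_, isIndepSet_blockIndepSet _, card_blockIndepSet _, rfl⟩
  have hval : ∀ a b : Finset (Fin K × Fin s), blockFunctional (blockPart a) (p b) =
      1 - (1 - ((a ∩ b).card : ℝ)) ^ 2 := fun a b => by
    rw [blockFunctional_blockIndepSet, sum_card_blockPart_inter]
  obtain ⟨I, J, hcover, havoid⟩ := h.exists_rectangle_cover
    (ι := {a : Finset (Fin K × Fin s) // a.Nonempty})
    (fun a => blockFunctional (blockPart a.1)) (fun _ => 1) p hp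
    (fun a => linearMap_le_of_mem_STAB _ _ fun S hS hk => by
      obtain ⟨b, hb⟩ := exists_blockFunctional_eq hS hk
      rw [hb, blockFunctional_blockIndepSet]
      nlinarith [sq_nonneg (1 - ∑ i, ((blockPart a.1 i ∩ b i).card : ℝ))])
    (fun a => by
      obtain ⟨x, hx⟩ := a.2
      exact ⟨p {x}, hp _, by rw [hval, Finset.inter_singleton_of_mem hx]; simp⟩)
  have := three_pow_le_of_rectangle_cover (ι := Option (Fin N))
    (fun a => if ha : a.Nonempty then some '' I ⟨a, ha⟩ else {none})
    (fun b => insert none (some '' J b)) (fun a b hd => ?_) (fun a b hc t ht => ?_)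
  · simpa using this
  · by_cases ha : a.Nonempty
    · obtain ⟨t, ht, ht'⟩ := hcover ⟨a, ha⟩ b (by
        rw [hval, Finset.disjoint_iff_inter_eq_empty.mp hd]; simp)
      exact ⟨some t, by simpa [ha] using ht, by simpa using ht'⟩
    · exact ⟨none, by simp [ha], by simp⟩
  · have ha : a.Nonempty := by
      obtain ⟨x, hx⟩ := Finset.card_pos.mp (hc ▸ Nat.one_pos)
      exact ⟨x, (Finset.mem_inter.mp hx).1⟩
    rw [dif_pos ha] at ht
    obtain ⟨t, ht, rfl⟩ := ht
    simpa using havoid ⟨a, ha⟩ b (by rw [hval, hc]; simp) t ht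

/-- There is no function `f : ℕ → ℝ` and constant `c` such that every `STAB_k(G)` admits an
extended formulation of size at most `f(k)·n^c`: for every `f` and `c` there are `k`, `n` and
a graph `G` on `n` vertices such that every extended formulation of `STAB_k(G)` has size
greater than `f(k)·n^c`. -/
theorem no_fpt_extension_for_stab (f : ℕ → ℝ) (c : ℕ) :
    ∃ (k n : ℕ) (V : Type) (inst : Fintype V) (G : SimpleGraph V),
      @Fintype.card V inst = n ∧
      ∀ N : ℕ, HasEF (STAB G k) N → f k * (n : ℝ) ^ c < (N : ℝ) := by
  obtain ⟨s, hs⟩ := pow_unbounded_of_one_lt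
    (f ((4 * c + 1) * (4 * c + 1)) * ((4 * c + 1) * (4 * c + 1)) ^ c + 1)
    (by norm_num : (1 : ℝ) < 3 / 2)
  refine ⟨(4 * c + 1) * (4 * c + 1), _, BlockVertex (4 * c + 1) s, inferInstance,
    blockGraph (4 * c + 1) s, rfl, fun N hN => ?_⟩
  have hcard : Fintype.card (BlockVertex (4 * c + 1) s) =
      (4 * c + 1) * (4 * c + 1) * 4 ^ s := by
    simp only [Fintype.card_prod, Fintype.card_fin, Fintype.card_finset, ← mul_pow]
    norm_num
  have hlow : (3 / 2 : ℝ) ^ ((4 * c + 1) * s) ≤ N + 1 := by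
    rw [div_pow, div_le_iff₀ (by positivity)]
    exact_mod_cast three_pow_le_of_hasEF_blockGraph hN
  have hsplit : (3 / 2 : ℝ) ^ s * (4 ^ s) ^ c ≤ (3 / 2 : ℝ) ^ ((4 * c + 1) * s) := by
    have h4 : ((4 : ℝ) ^ s) ^ c ≤ (3 / 2 : ℝ) ^ (4 * (s * c)) := by
      rw [← pow_mul, pow_mul (3 / 2 : ℝ) 4]
      exact pow_le_pow_left₀ (by norm_num) (by norm_num) _
    calc (3 / 2 : ℝ) ^ s * (4 ^ s) ^ c ≤ (3 / 2 : ℝ) ^ s * (3 / 2 : ℝ) ^ (4 * (s * c)) := by gcongr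
      _ = _ := by rw [← pow_add]; ring_nf
  have hone : (1 : ℝ) ≤ ((4 : ℝ) ^ s) ^ c := one_le_pow₀ (one_le_pow₀ (by norm_num))
  rw [hcard]
  push_cast
  rw [mul_pow _ ((4 : ℝ) ^ s)]
  have := mul_lt_mul_of_pos_right hs (zero_lt_one.trans_le hone)
  nlinarith
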